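/- Let f satisfy (H) be a regular nonlinearity (a_f = ∞) such that lim_{t→∞} f(t)f''(t)/f'(t)² = 0. Then for every dimension n and every smooth bounded domain Ω ⊂ ℝⁿ, any sequence (u_m) of semistable solutions of (N_{λ_m}) satisfies sup_m ‖u_m‖_{L^∞(Ω)} < ∞; in particular the extremal solution u* of (N_λ) is bounded in every dimension. -/

import Mathlib

open MeasureTheory Filter Topology Real Set

noncomputable section

/-- The Laplacian of a real-valued function on Euclidean space. -/
def lap {n : ℕ} (u : EuclideanSpace ℝ (Fin n) → ℝ) (x : EuclideanSpace ℝ (Fin n)) : ℝ :=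
  ∑ i : Fin n, iteratedFDeriv ℝ 2 u x ![EuclideanSpace.single i (1:ℝ), EuclideanSpace.single i (1:ℝ)]

/-- A bounded (smooth) domain. -/
def GoodDomain {n : ℕ} (Ω : Set (EuclideanSpace ℝ (Fin n))) : Prop :=
  IsOpen Ω ∧ Bornology.IsBounded Ω ∧ Ω.Nonempty

/-- The domain `[0, a_f)` of the nonlinearity. -/
def domf (a : EReal) : Set ℝ := {t : ℝ | 0 ≤ t ∧ (t : EReal) < a}

/-- The filter of `t → a_f⁻`. -/
def afFilter (a : EReal) : Filter ℝ :=
  if a = ⊤ then Filter.atTop else nhdsWithin a.toReal (Set.Iio a.toReal)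

/-- Hypothesis (H) on the nonlinearity `f : [0, a_f) → ℝ₊`. -/
structure HypH (a : EReal) (f : ℝ → ℝ) : Prop where
  a_pos : 0 < a
  smooth : ContDiffOn ℝ (⊤ : ℕ∞) f (domf a)
  mono : StrictMonoOn f (domf a)
  convex : ConvexOn ℝ (domf a) f
  f0_pos : 0 < f 0
  pos : ∀ t ∈ domf a, 0 < f t
  blowup : Filter.Tendsto f (afFilter a) Filter.atTop
  superlinear : a = ⊤ → Filter.Tendsto (fun t => f t / t) Filter.atTop Filter.atTop

/-- `τ₋ = liminf_{t → a_f} f f'' / (f')²`. -/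
def tauMinus (a : EReal) (f : ℝ → ℝ) : ℝ :=
  Filter.liminf (fun t => f t * deriv (deriv f) t / (deriv f t) ^ 2) (afFilter a)

/-- `τ₊ = limsup_{t → a_f} f f'' / (f')²`. -/
def tauPlus (a : EReal) (f : ℝ → ℝ) : ℝ :=
  Filter.limsup (fun t => f t * deriv (deriv f) t / (deriv f t) ^ 2) (afFilter a)

/-- `u` is a (smooth, `[0,a_f)`-valued) solution of `Δ²u = λ f(u)` in `Ω`,
`u = Δu = 0` on `∂Ω`. -/
def Solves {n : ℕ} (Ω : Set (EuclideanSpace ℝ (Fin n))) (a : EReal) (lam : ℝ)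
    (f : ℝ → ℝ) (u : EuclideanSpace ℝ (Fin n) → ℝ) : Prop :=
  ContDiff ℝ (⊤ : ℕ∞) u ∧ (∀ x ∈ Ω, 0 ≤ u x ∧ (u x : EReal) < a) ∧
  (∀ x ∈ Ω, lap (lap u) x = lam * f (u x)) ∧
  (∀ x ∈ frontier Ω, u x = 0) ∧ (∀ x ∈ frontier Ω, lap u x = 0)

/-- `u` is a semistable solution: the second variation is nonnegative over
test functions in `H² ∩ H¹₀` (modelled by smooth functions vanishing on `∂Ω`). -/
def Semistable {n : ℕ} (Ω : Set (EuclideanSpace ℝ (Fin n))) (lam : ℝ)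
    (f : ℝ → ℝ) (u : EuclideanSpace ℝ (Fin n) → ℝ) : Prop :=
  ∀ φ : EuclideanSpace ℝ (Fin n) → ℝ, ContDiff ℝ (⊤ : ℕ∞) φ → (∀ x ∈ frontier Ω, φ x = 0) →
    0 ≤ ∫ x in Ω, ((lap φ x) ^ 2 - lam * deriv f (u x) * (φ x) ^ 2)

/-- `u` satisfies the stability inequality
`√λ ∫ √(f'(u)) φ² ≤ ∫ |∇φ|²` for all `φ ∈ H¹₀(Ω)`
(modelled by smooth compactly supported test functions). -/
def StabIneq {n : ℕ} (Ω : Set (EuclideanSpace ℝ (Fin n))) (lam : ℝ)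
    (f : ℝ → ℝ) (u : EuclideanSpace ℝ (Fin n) → ℝ) : Prop :=
  ∀ φ : EuclideanSpace ℝ (Fin n) → ℝ, ContDiff ℝ (⊤ : ℕ∞) φ → HasCompactSupport φ →
    tsupport φ ⊆ Ω →
    Real.sqrt lam * ∫ x in Ω, Real.sqrt (deriv f (u x)) * (φ x) ^ 2 ≤
      ∫ x in Ω, ‖gradient φ x‖ ^ 2

/-- The quartic polynomial `P_f(α, τ₋, τ₊)`. -/
def Pf (τm τp α : ℝ) : ℝ :=
  (2 - τm) ^ 2 * α ^ 4 - 8 * (2 - τp) * α ^ 2 + 4 * (4 - 3 * τp) * α - 4 * (1 - τp)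

/-- `F(t) = ∫₀ᵗ f(s) ds`. -/
def Fint (f : ℝ → ℝ) (t : ℝ) : ℝ := ∫ s in (0:ℝ)..t, f s

/-- `f̃(t) = f(t) - f(0)`. -/
def ftil (f : ℝ → ℝ) (t : ℝ) : ℝ := f t - f 0

/-- `Θ(t) = ∫₀ᵗ θ'(s)² ds`. -/
def Theta (θ : ℝ → ℝ) (t : ℝ) : ℝ := ∫ s in (0:ℝ)..t, (deriv θ s) ^ 2

section PDE

variable {n : ℕ}

lemma lap_eq (a : EuclideanSpace ℝ (Fin n) → ℝ) (x : EuclideanSpace ℝ (Fin n)) :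
    lap a x = ∑ i : Fin n, fderiv ℝ (fderiv ℝ a) x (EuclideanSpace.single i (1:ℝ))
      (EuclideanSpace.single i (1:ℝ)) := by
  simp [lap, iteratedFDeriv_two_apply]

lemma lap_smooth {a : EuclideanSpace ℝ (Fin n) → ℝ} (ha : ContDiff ℝ (⊤ : ℕ∞) a) :
    ContDiff ℝ (⊤ : ℕ∞) (lap a) := by
  have h1 : ContDiff ℝ (⊤ : ℕ∞) (fderiv ℝ a) := ha.fderiv_right (by simp)
  have h2 : ContDiff ℝ (⊤ : ℕ∞) (fderiv ℝ (fderiv ℝ a)) := h1.fderiv_right (by simp)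
  have : lap a = fun x => ∑ i : Fin n, fderiv ℝ (fderiv ℝ a) x (EuclideanSpace.single i (1:ℝ))
      (EuclideanSpace.single i (1:ℝ)) := funext (lap_eq a)
  rw [this]
  exact ContDiff.sum fun i _ => (h2.clm_apply contDiff_const).clm_apply contDiff_const

lemma lap_add {a b : EuclideanSpace ℝ (Fin n) → ℝ} (ha : ContDiff ℝ (⊤ : ℕ∞) a)
    (hb : ContDiff ℝ (⊤ : ℕ∞) b) (x : EuclideanSpace ℝ (Fin n)) :
    lap (fun y => a y + b y) x = lap a x + lap b x := by
  have h1 : ContDiff ℝ (⊤ : ℕ∞) (fderiv ℝ a) := ha.fderiv_right (by simp)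
  have h2 : ContDiff ℝ (⊤ : ℕ∞) (fderiv ℝ b) := hb.fderiv_right (by simp)
  have e1 : fderiv ℝ (fun y => a y + b y) = fun y => fderiv ℝ a y + fderiv ℝ b y := by
    ext1 y
    exact fderiv_fun_add (ha.differentiable (by simp) y) (hb.differentiable (by simp) y)
  simp only [lap_eq, e1]
  rw [fderiv_fun_add (h1.differentiable (by simp) x) (h2.differentiable (by simp) x)]
  simp [Finset.sum_add_distrib]

lemma lap_neg (a : EuclideanSpace ℝ (Fin n) → ℝ) (x : EuclideanSpace ℝ (Fin n)) :
    lap (fun y => - a y) x = - lap a x := by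
  have e1 : fderiv ℝ (fun y => - a y) = fun y => - fderiv ℝ a y := by
    ext1 y
    exact fderiv_fun_neg
  simp only [lap_eq, e1]
  rw [fderiv_fun_neg]
  simp

lemma lap_quad (c d : ℝ) (x0 x : EuclideanSpace ℝ (Fin n)) :
    lap (fun y => c * (d - ‖y - x0‖ ^ 2)) x = - (2 * n * c) := by
  have e1 : fderiv ℝ (fun y => c * (d - ‖y - x0‖ ^ 2)) = fun y =>
      (-(2 * c)) • (innerSL ℝ (y - x0)) := by
    ext1 y
    have h0 : HasFDerivAt (fun y : EuclideanSpace ℝ (Fin n) => y - x0)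
      (ContinuousLinearMap.id ℝ _) y := (hasFDerivAt_id y).sub_const x0
    have h := (((h0.norm_sq).const_sub d).const_mul c).fderiv
    rw [h]
    ext w
    simp
    ring
  simp only [lap_eq, e1]
  have h2 : HasFDerivAt (fun y : EuclideanSpace ℝ (Fin n) => (-(2 * c)) • (innerSL ℝ (y - x0)))
      ((-(2 * c)) • (innerSL ℝ : EuclideanSpace ℝ (Fin n) →L[ℝ] _)) x := by
    have h0 : HasFDerivAt (fun y : EuclideanSpace ℝ (Fin n) => y - x0)
      (ContinuousLinearMap.id ℝ _) x := (hasFDerivAt_id x).sub_const x0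
    have := ((innerSL ℝ : EuclideanSpace ℝ (Fin n) →L[ℝ] _).hasFDerivAt.comp x h0).const_smul
      (-(2*c))
    exact this
  rw [h2.fderiv]
  have h3 : ∀ i : Fin n, ((-(2 * c)) • (innerSL ℝ : EuclideanSpace ℝ (Fin n) →L[ℝ] _))
      (EuclideanSpace.single i (1:ℝ)) (EuclideanSpace.single i (1:ℝ)) = -(2 * c) := by
    intro i
    change -(2 * c) * inner ℝ (EuclideanSpace.single i (1:ℝ)) (EuclideanSpace.single i (1:ℝ)) = _
    simp
  rw [Finset.sum_congr rfl fun i _ => h3 i]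
  simp
  ring

lemma quad_smooth (c d : ℝ) (x0 : EuclideanSpace ℝ (Fin n)) :
    ContDiff ℝ (⊤ : ℕ∞) (fun y => c * (d - ‖y - x0‖ ^ 2)) :=
  contDiff_const.mul (contDiff_const.sub ((contDiff_id.sub contDiff_const).norm_sq ℝ))

lemma hess_nonpos {a : EuclideanSpace ℝ (Fin n) → ℝ} (ha : ContDiff ℝ (⊤ : ℕ∞) a)
    {x : EuclideanSpace ℝ (Fin n)} (hx : IsLocalMax a x) (w : EuclideanSpace ℝ (Fin n)) :
    fderiv ℝ (fderiv ℝ a) x w w ≤ 0 := by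
  by_contra hcon
  push Not at hcon
  have h1 : ContDiff ℝ (⊤ : ℕ∞) (fderiv ℝ a) := ha.fderiv_right (by simp)
  set p : ℝ → ℝ := fun t => a (x + t • w) with hp
  have hl : ∀ t : ℝ, HasDerivAt (fun t : ℝ => x + t • w) w t := fun t => by
    simpa using ((hasDerivAt_id t).smul_const w).const_add x
  have hd : deriv p = fun t => fderiv ℝ a (x + t • w) w := by
    ext t
    exact ((ha.differentiable (by simp) (x + t • w)).hasFDerivAt.comp_hasDerivAt t (hl t)).deriv
  have hd2 : deriv (deriv p) 0 = fderiv ℝ (fderiv ℝ a) x w w := by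
    rw [hd]
    have h2 := (h1.differentiable (by simp) (x + (0:ℝ) • w)).hasFDerivAt.comp_hasDerivAt (0:ℝ) (hl 0)
    have h3 := h2.clm_apply (hasDerivAt_const (0:ℝ) w)
    have := h3.deriv
    simpa using this
  have hc : Continuous (fun t : ℝ => x + t • w) := by fun_prop
  have hmax : IsLocalMax p 0 := by
    have ht : Tendsto (fun t : ℝ => x + t • w) (𝓝 0) (𝓝 x) := by
      have := hc.tendsto 0
      simpa using this
    have := ht.eventually hx
    simpa [IsLocalMax, IsMaxFilter, hp] using this
  have hpc : ContinuousAt p 0 := (ha.continuous.comp hc).continuousAt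
  have hmin := isLocalMin_of_deriv_deriv_pos (by rw [hd2]; exact hcon) hmax.deriv_eq_zero hpc
  have heq : p =ᶠ[𝓝 0] fun _ => p 0 := by
    filter_upwards [hmax, hmin] with t h1 h2 using le_antisymm h1 h2
  have := heq.deriv.deriv_eq
  rw [hd2] at this
  simp at this
  linarith

lemma lap_nonpos {a : EuclideanSpace ℝ (Fin n) → ℝ} (ha : ContDiff ℝ (⊤ : ℕ∞) a)
    {x : EuclideanSpace ℝ (Fin n)} (hx : IsLocalMax a x) : lap a x ≤ 0 := by
  rw [lap_eq]
  exact Finset.sum_nonpos fun i _ => hess_nonpos ha hx _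

/-- Maximum principle. -/
lemma maxp {a : EuclideanSpace ℝ (Fin n) → ℝ} (ha : ContDiff ℝ (⊤ : ℕ∞) a)
    {Ω : Set (EuclideanSpace ℝ (Fin n))} (ho : IsOpen Ω) (hb : Bornology.IsBounded Ω)
    (hl : ∀ x ∈ Ω, 0 < lap a x) (hf : ∀ x ∈ frontier Ω, a x ≤ 0) :
    ∀ x ∈ Ω, a x < 0 := by
  have hK : IsCompact (closure Ω) := hb.isCompact_closure
  have key : ∀ x ∈ Ω, a x ≤ 0 := by
    intro x hx
    obtain ⟨y, hy, hmax⟩ := hK.exists_isMaxOn ⟨x, subset_closure hx⟩ ha.continuous.continuousOn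
    have hxy : a x ≤ a y := hmax (subset_closure hx)
    by_cases hyO : y ∈ Ω
    · have : IsLocalMax a y := by
        filter_upwards [ho.mem_nhds hyO] with z hz using hmax (subset_closure hz)
      exact absurd (lap_nonpos ha this) (not_le.2 (hl y hyO))
    · exact hxy.trans (hf y ⟨hy, by rwa [ho.interior_eq]⟩)
  intro x hx
  refine lt_of_le_of_ne (key x hx) fun h0 => ?_
  have : IsLocalMax a x := by
    filter_upwards [ho.mem_nhds hx] with z hz
    rw [h0]; exact key z hz
  exact absurd (lap_nonpos ha this) (not_le.2 (hl x hx))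

/-- Upper barrier. -/
lemma upper_barrier {a : EuclideanSpace ℝ (Fin n) → ℝ} (ha : ContDiff ℝ (⊤ : ℕ∞) a)
    {Ω : Set (EuclideanSpace ℝ (Fin n))} (ho : IsOpen Ω) {R : ℝ} (hn : 0 < n)
    (hR : Ω ⊆ Metric.closedBall 0 R)
    {V : ℝ} (hV : 0 < V) (hl : ∀ x ∈ Ω, - lap a x ≤ V) (hf : ∀ x ∈ frontier Ω, a x ≤ 0) :
    ∀ x ∈ Ω, a x ≤ V * R ^ 2 := by
  have hb : Bornology.IsBounded Ω := Metric.isBounded_closedBall.subset hR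
  have hsm : ContDiff ℝ (⊤ : ℕ∞) (fun y => a y + -(V * (R ^ 2 - ‖y - 0‖ ^ 2))) :=
    ha.add (quad_smooth V (R^2) 0).neg
  have hn' : (1:ℝ) ≤ n := by exact_mod_cast hn
  have := maxp hsm ho hb ?_ ?_
  · intro x hx
    have h := this x hx
    have : 0 ≤ V * ‖x - 0‖ ^ 2 := by positivity
    nlinarith
  · intro x hx
    rw [lap_add ha (quad_smooth V (R^2) 0).neg, lap_neg, lap_quad]
    have := hl x hx
    nlinarith
  · intro x hx
    have h1 := hf x hx
    have h2 : x ∈ Metric.closedBall (0 : EuclideanSpace ℝ (Fin n)) R :=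
      closure_minimal hR Metric.isClosed_closedBall (frontier_subset_closure hx)
    have h3 : ‖x - 0‖ ≤ R := by simpa using h2
    have h4 : ‖x - 0‖ ^ 2 ≤ R ^ 2 := by gcongr
    nlinarith

/-- Lower barrier. -/
lemma lower_barrier {a : EuclideanSpace ℝ (Fin n) → ℝ} (ha : ContDiff ℝ (⊤ : ℕ∞) a)
    {x0 : EuclideanSpace ℝ (Fin n)} {r c : ℝ} (hr : 0 < r) (hc : 0 < c) (hn : 0 < n)
    (hpos : ∀ x ∈ Metric.closedBall x0 r, 0 ≤ a x)
    (hl : ∀ x ∈ Metric.closedBall x0 r, c ≤ - lap a x) :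
    ∀ x ∈ Metric.closedBall x0 (r / 2), c * r ^ 2 / (8 * n) ≤ a x := by
  have hn' : (1:ℝ) ≤ n := by exact_mod_cast hn
  have hsm : ContDiff ℝ (⊤ : ℕ∞) (fun y => (c / (4 * n)) * (r ^ 2 - ‖y - x0‖ ^ 2) + - a y) :=
    (quad_smooth _ _ _).add ha.neg
  have := maxp hsm (Metric.isOpen_ball (x := x0) (ε := r)) Metric.isBounded_ball ?_ ?_
  · intro x hx
    have hx1 : ‖x - x0‖ ≤ r / 2 := by simpa [dist_eq_norm] using hx
    have h := this x (by simp [dist_eq_norm]; linarith)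
    have h4 : ‖x - x0‖ ^ 2 ≤ (r / 2) ^ 2 := by gcongr
    have h5 : c * r ^ 2 / (8 * n) = (c / (4 * n)) * (r ^ 2 / 2) := by field_simp; ring
    rw [h5]
    have h6 : (c / (4 * n)) * (r ^ 2 / 2) ≤ (c / (4 * n)) * (r ^ 2 - ‖x - x0‖ ^ 2) := by
      gcongr; nlinarith
    linarith
  · intro x hx
    rw [lap_add (quad_smooth _ _ _) ha.neg, lap_neg, lap_quad]
    have := hl x (Metric.ball_subset_closedBall hx)
    have h7 : 2 * (n:ℝ) * (c / (4 * n)) = c / 2 := by field_simp; ring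
    rw [h7]
    linarith
  · intro x hx
    rw [frontier_ball x0 hr.ne'] at hx
    have h1 : ‖x - x0‖ = r := by simpa [dist_eq_norm] using hx
    have := hpos x (Metric.sphere_subset_closedBall hx)
    simp only [h1]
    linarith

end PDE

section ABP

variable {n : ℕ}

lemma det_bound (A : EuclideanSpace ℝ (Fin n) →L[ℝ] EuclideanSpace ℝ (Fin n))
    (hs : ∀ w z, inner ℝ (A w) z = inner ℝ w (A z)) (hneg : ∀ w, inner ℝ (A w) w ≤ 0) :
    |A.det| ≤ (- ∑ i : Fin n, inner ℝ (A (EuclideanSpace.single i (1:ℝ)))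
      (EuclideanSpace.single i (1:ℝ))) ^ n := by
  set T : EuclideanSpace ℝ (Fin n) →ₗ[ℝ] EuclideanSpace ℝ (Fin n) := -(A : _ →ₗ[ℝ] _) with hT
  have hsym : T.IsSymmetric := by
    intro w z
    simp [hT, hs]
  have hpos : T.IsPositive := by
    refine ⟨hsym, fun w => ?_⟩
    simp [hT]
    exact hneg w
  have hn : Module.finrank ℝ (EuclideanSpace ℝ (Fin n)) = n := by simp
  have hdet := hsym.det_eq_prod_eigenvalues hn
  have htr := hsym.trace_eq_sum_eigenvalues hn
  have htr2 := LinearMap.trace_eq_sum_inner T (EuclideanSpace.basisFun (Fin n) ℝ)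
  have hev : ∀ i, 0 ≤ hsym.eigenvalues hn i := fun i => hpos.nonneg_eigenvalues hn i
  have h1 : |A.det| = |LinearMap.det T| := by
    have : LinearMap.det T = (-1) ^ n * A.det := by
      have h0 : T = (-1 : ℝ) • (A : EuclideanSpace ℝ (Fin n) →ₗ[ℝ] EuclideanSpace ℝ (Fin n)) := by
        rw [hT]; ext; simp
      rw [h0, LinearMap.det_smul, hn]
    rw [this, abs_mul]; simp
  have h2 : (- ∑ i : Fin n, inner ℝ (A (EuclideanSpace.single i (1:ℝ)))
      (EuclideanSpace.single i (1:ℝ))) = ∑ i, hsym.eigenvalues hn i := by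
    have : (LinearMap.trace ℝ _) T = ∑ i, hsym.eigenvalues hn i := by simpa using htr
    rw [← this, htr2, ← Finset.sum_neg_distrib]
    refine Finset.sum_congr rfl fun i _ => ?_
    simp [hT, hs]
  rw [h1, h2, hdet]
  have h3 : ∏ i, hsym.eigenvalues hn i ≤ ∏ i : Fin n, ∑ j, hsym.eigenvalues hn j :=
    Finset.prod_le_prod (fun i _ => hev i) fun i _ =>
      Finset.single_le_sum (fun j _ => hev j) (Finset.mem_univ i)
  have h4 : 0 ≤ ∏ i, hsym.eigenvalues hn i := Finset.prod_nonneg fun i _ => hev i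
  simpa [abs_of_nonneg h4] using h3

lemma abp {a : EuclideanSpace ℝ (Fin n) → ℝ} (ha : ContDiff ℝ (⊤ : ℕ∞) a)
    {Ω : Set (EuclideanSpace ℝ (Fin n))} (ho : IsOpen Ω) {R : ℝ} (hR0 : 0 < R)
    (hR : Ω ⊆ Metric.closedBall 0 R) (hf : ∀ x ∈ frontier Ω, a x = 0)
    {x0 : EuclideanSpace ℝ (Fin n)} (hx0 : x0 ∈ Ω) (hM : 0 < a x0) :
    volume.real (Metric.ball (0 : EuclideanSpace ℝ (Fin n)) 1) * (a x0 / (2 * R)) ^ n ≤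
      ∫ x in Ω, |lap a x| ^ n := by
  have hb : Bornology.IsBounded Ω := Metric.isBounded_closedBall.subset hR
  have hK : IsCompact (closure Ω) := hb.isCompact_closure
  have hcl : closure Ω ⊆ Metric.closedBall 0 R := closure_minimal hR Metric.isClosed_closedBall
  have h1 : ContDiff ℝ (⊤ : ℕ∞) (fderiv ℝ a) := ha.fderiv_right (by simp)
  have h2 : ContDiff ℝ (⊤ : ℕ∞) (fderiv ℝ (fderiv ℝ a)) := h1.fderiv_right (by simp)
  set J : StrongDual ℝ (EuclideanSpace ℝ (Fin n)) →L[ℝ] EuclideanSpace ℝ (Fin n) :=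
    LinearMap.toContinuousLinearMap
      { toFun := fun l => (InnerProductSpace.toDual ℝ (EuclideanSpace ℝ (Fin n))).symm l
        map_add' := fun l m => by simp
        map_smul' := fun c l => by simp } with hJ
  have hJi : ∀ l z, inner ℝ (J l) z = l z := by
    intro l z
    simp [hJ]
  set g : EuclideanSpace ℝ (Fin n) → EuclideanSpace ℝ (Fin n) := fun x => J (fderiv ℝ a x) with hg
  set A : EuclideanSpace ℝ (Fin n) → EuclideanSpace ℝ (Fin n) →L[ℝ] EuclideanSpace ℝ (Fin n) :=
    fun x => J.comp (fderiv ℝ (fderiv ℝ a) x) with hA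
  have hgA : ∀ x, HasFDerivAt g (A x) x := fun x =>
    J.hasFDerivAt.comp x (h1.differentiable (by simp) x).hasFDerivAt
  set Γ : Set (EuclideanSpace ℝ (Fin n)) := Ω ∩ ⋂ w, {x | fderiv ℝ (fderiv ℝ a) x w w ≤ 0} with hΓ
  have hΓm : MeasurableSet Γ := by
    refine ho.measurableSet.inter (IsClosed.measurableSet ?_)
    refine isClosed_iInter fun w => isClosed_le ?_ continuous_const
    exact (h2.continuous.clm_apply continuous_const).clm_apply continuous_const
  have hsub : Metric.ball (0 : EuclideanSpace ℝ (Fin n)) (a x0 / (2 * R)) ⊆ g '' Γ := by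
    intro p hp
    have hp1 : ‖p‖ < a x0 / (2 * R) := by simpa using hp
    have hp2 : ‖p‖ * (2 * R) < a x0 := by rwa [lt_div_iff₀ (by positivity)] at hp1
    have hbs : ContDiff ℝ (⊤ : ℕ∞) (fun x => a x - inner ℝ p x) :=
      ha.sub (contDiff_const.inner ℝ contDiff_id)
    obtain ⟨y, hy, hmax⟩ := hK.exists_isMaxOn ⟨x0, subset_closure hx0⟩ hbs.continuous.continuousOn
    have hyO : y ∈ Ω := by
      by_contra hyO
      have h3 := hf y ⟨hy, by rwa [ho.interior_eq]⟩
      have h4 : a x0 - inner ℝ p x0 ≤ a y - inner ℝ p y := hmax (subset_closure hx0)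
      have h5 : inner ℝ p (x0 - y) ≤ ‖p‖ * (2 * R) := by
        refine (real_inner_le_norm _ _).trans ?_
        gcongr
        have e1 : ‖x0‖ ≤ R := by simpa using hR hx0
        have e2 : ‖y‖ ≤ R := by simpa using hcl hy
        linarith [norm_sub_le x0 y]
      rw [inner_sub_right] at h5
      linarith
    have hloc : IsLocalMax (fun x => a x - inner ℝ p x) y := by
      filter_upwards [ho.mem_nhds hyO] with z hz using hmax (subset_closure hz)
    have hder : ∀ x, HasFDerivAt (fun x => a x - inner ℝ p x) (fderiv ℝ a x - innerSL ℝ p) x :=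
      fun x => (ha.differentiable (by simp) x).hasFDerivAt.sub (innerSL ℝ p).hasFDerivAt
    have hfd : fderiv ℝ (fun x => a x - inner ℝ p x) = fun x => fderiv ℝ a x - innerSL ℝ p :=
      funext fun x => (hder x).fderiv
    refine ⟨y, ⟨hyO, ?_⟩, ?_⟩
    · rw [mem_iInter]
      intro w
      have := hess_nonpos hbs hloc w
      rw [hfd, fderiv_sub_const] at this
      exact this
    · have h3 := hloc.fderiv_eq_zero
      rw [hfd] at h3
      have h4 : fderiv ℝ a y = innerSL ℝ p := sub_eq_zero.1 h3
      refine ext_inner_right ℝ fun z => ?_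
      rw [hg]
      simp only [hJi, h4]
      rfl
  have hdet : ∀ x ∈ Γ, |(A x).det| ≤ |lap a x| ^ n := by
    intro x hx
    have hsy : IsSymmSndFDerivAt ℝ a x := ha.contDiffAt.isSymmSndFDerivAt (by
      simp only [minSmoothness_of_isRCLikeNormedField]
      exact WithTop.coe_le_coe.2 (le_top : (2:ℕ∞) ≤ ⊤))
    have hAi : ∀ w z, inner ℝ (A x w) z = fderiv ℝ (fderiv ℝ a) x w z := fun w z => hJi _ _
    refine (det_bound (A x) ?_ ?_).trans ?_
    · intro w z
      rw [real_inner_comm (A x z) w, hAi, hAi]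
      exact hsy w z
    · intro w
      rw [hAi]
      exact mem_iInter.1 hx.2 w
    · simp only [hAi]
      rw [← lap_eq]
      rw [← abs_pow]
      refine (le_abs_self _).trans (le_of_eq ?_)
      rw [abs_pow, abs_pow, abs_neg]
  have hmeas := (measure_mono hsub).trans
    (addHaar_image_le_lintegral_abs_det_fderiv volume hΓm fun x _ => (hgA x).hasFDerivWithinAt)
  have hIntOn : IntegrableOn (fun x => |lap a x| ^ n) Ω :=
    (((lap_smooth ha).continuous.abs.pow n).continuousOn.integrableOn_compact hK).mono_set
      subset_closure
  have h6 : (∫⁻ x in Γ, ENNReal.ofReal |(A x).det|) ≤ ENNReal.ofReal (∫ x in Ω, |lap a x| ^ n) := by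
    rw [ofReal_integral_eq_lintegral_ofReal hIntOn (ae_of_all _ fun x => by positivity)]
    refine (setLIntegral_mono' hΓm fun x hx => ENNReal.ofReal_le_ofReal (hdet x hx)).trans ?_
    exact lintegral_mono_set inter_subset_left
  have h7 := hmeas.trans h6
  rw [Measure.addHaar_ball_of_pos _ _ (by positivity), finrank_euclideanSpace_fin] at h7
  have h8 := ENNReal.toReal_mono ENNReal.ofReal_ne_top h7
  rw [ENNReal.toReal_mul, ENNReal.toReal_ofReal (by positivity),
    ENNReal.toReal_ofReal (integral_nonneg fun x => by positivity)] at h8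
  rw [mul_comm]
  exact h8

end ABP

section Nonlin

lemma domf_top : domf ⊤ = Ici (0:ℝ) := by
  ext t; simp [domf, EReal.coe_lt_top]

lemma f_smooth {f : ℝ → ℝ} (hf : HypH ⊤ f) {t : ℝ} (ht : 0 < t) :
    ContDiffAt ℝ (⊤ : ℕ∞) f t := by
  have := hf.smooth
  rw [domf_top] at this
  exact this.contDiffAt (Ici_mem_nhds ht)

lemma f_diff {f : ℝ → ℝ} (hf : HypH ⊤ f) {t : ℝ} (ht : 0 < t) : DifferentiableAt ℝ f t :=
  (f_smooth hf ht).differentiableAt (by simp)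

lemma f'_smooth {f : ℝ → ℝ} (hf : HypH ⊤ f) : ContDiffOn ℝ (⊤ : ℕ∞) (deriv f) (Ioi 0) := by
  have h : ContDiffOn ℝ (⊤ : ℕ∞) f (Ioi 0) := fun t ht => (f_smooth hf ht).contDiffWithinAt
  exact h.deriv_of_isOpen isOpen_Ioi (by simp)

lemma tangent {f : ℝ → ℝ} (hf : HypH ⊤ f) {s t : ℝ} (hs : 0 ≤ s) (hst : s < t) :
    f t - f s ≤ deriv f t * (t - s) := by
  have hc := hf.convex
  rw [domf_top] at hc
  have := hc.slope_le_deriv (mem_Ici.2 hs) (mem_Ici.2 (hs.trans hst.le)) hst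
    (f_diff hf (hs.trans_lt hst))
  rw [slope_def_field, div_le_iff₀ (by linarith)] at this
  exact this

lemma f'_tendsto {f : ℝ → ℝ} (hf : HypH ⊤ f) : Tendsto (deriv f) atTop atTop := by
  have h1 := tendsto_atTop_add_const_right atTop (- f 0) (hf.superlinear rfl)
  refine tendsto_atTop_mono' _ ?_ h1
  filter_upwards [eventually_ge_atTop 1] with t ht
  have h := tangent hf le_rfl (by linarith : (0:ℝ) < t)
  have h0 := hf.f0_pos
  have : f t / t ≤ deriv f t + f 0 / t := by
    rw [← sub_le_iff_le_add, ← sub_div, div_le_iff₀ (by linarith)]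
    linarith
  have h2 : f 0 / t ≤ f 0 := div_le_self h0.le ht
  linarith

lemma f'_mono {f : ℝ → ℝ} (hf : HypH ⊤ f) : MonotoneOn (deriv f) (Ioi 0) := by
  have hc := hf.convex
  rw [domf_top] at hc
  exact (hc.subset Ioi_subset_Ici_self (convex_Ioi 0)).monotoneOn_deriv fun x hx => f_diff hf hx

lemma f_mono {f : ℝ → ℝ} (hf : HypH ⊤ f) : MonotoneOn f (Ici 0) := by
  have := hf.mono.monotoneOn
  rwa [domf_top] at this

lemma f'_nonneg {f : ℝ → ℝ} (hf : HypH ⊤ f) {t : ℝ} (ht : 0 < t) : 0 ≤ deriv f t := by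
  have h := tangent hf le_rfl ht
  have h2 := f_mono hf (mem_Ici.2 le_rfl) (mem_Ici.2 ht.le) ht.le
  by_contra hc
  push Not at hc
  nlinarith

lemma g_lower {f : ℝ → ℝ} (hf : HypH ⊤ f) :
    ∃ K : ℝ, ∀ t > 0, t - K ≤ (t * deriv f t - f t) * t := by
  obtain ⟨T0, hT0⟩ := eventually_atTop.1 ((f'_tendsto hf).eventually_ge_atTop (f 1 + 1))
  set T := max T0 2 with hT
  have hT2 : (2:ℝ) ≤ T := le_max_right _ _
  have h0 := hf.f0_pos
  refine ⟨T * (1 + f 0), fun t ht => ?_⟩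
  rcases le_or_gt T t with h | h
  · have h1 := hT0 t ((le_max_left _ _).trans h)
    have h2 := tangent hf zero_le_one (by linarith : (1:ℝ) < t)
    have h3 : 1 ≤ t * deriv f t - f t := by nlinarith
    have h4 : 0 ≤ T * (1 + f 0) := by positivity
    nlinarith
  · have h1 := tangent hf le_rfl ht
    have h2 : - f 0 ≤ t * deriv f t - f t := by nlinarith
    have h3 : - f 0 * t ≤ (t * deriv f t - f t) * t := by gcongr
    nlinarith

lemma growth {f : ℝ → ℝ} (hf : HypH ⊤ f)
    (hτ : Filter.Tendsto (fun t => f t * deriv (deriv f) t / (deriv f t) ^ 2)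
      Filter.atTop (nhds 0)) (n : ℕ) :
    ∃ B : ℝ, 0 < B ∧ ∀ t, 0 ≤ t → f t ^ (2 * n) ≤ B * (1 + t) ^ (2 * n + 1) := by
  have hN : (0:ℝ) < 1 / (2 * n + 1) := by positivity
  have h0 := hf.f0_pos
  have hfp : ∀ t, 0 ≤ t → 0 < f t := fun t ht => hf.pos t (by rw [domf_top]; exact ht)
  obtain ⟨t1, ht1⟩ := eventually_atTop.1 (((hτ.eventually (gt_mem_nhds hN)).and
    ((f'_tendsto hf).eventually_ge_atTop (f 0 + 1))).and (eventually_ge_atTop (1:ℝ)))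
  set t0 := max t1 1 with ht0
  have hge : ∀ t, t0 ≤ t → 0 < t := fun t ht => lt_of_lt_of_le one_pos ((le_max_right _ _).trans ht)
  have hprop : ∀ t, t0 ≤ t → (2 * n + 1) * (f t * deriv (deriv f) t) ≤ deriv f t ^ 2 ∧
      f 0 + 1 ≤ deriv f t := by
    intro t ht
    obtain ⟨⟨h1, h2⟩, h3⟩ := ht1 t ((le_max_left _ _).trans ht)
    have h4 : 0 < deriv f t := by linarith
    refine ⟨?_, h2⟩
    rw [div_lt_iff₀ (by positivity), div_mul_eq_mul_div, lt_div_iff₀ (by positivity)] at h1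
    linarith
  set k : ℝ → ℝ := fun t => deriv f t ^ (2 * n + 1) / f t with hk
  have hder : ∀ t, t0 ≤ t → HasDerivAt k
      ((((2 * n + 1 : ℕ) : ℝ) * deriv f t ^ (2 * n) * deriv (deriv f) t * f t -
        deriv f t ^ (2 * n + 1) * deriv f t) / f t ^ 2) t := by
    intro t ht
    have h1 : HasDerivAt (deriv f) (deriv (deriv f) t) t :=
      (((f'_smooth hf).contDiffAt (Ioi_mem_nhds (hge t ht))).differentiableAt (by simp)).hasDerivAt
    have h2 := (f_diff hf (hge t ht)).hasDerivAt
    have := (h1.pow (2 * n + 1)).div h2 (hfp t (hge t ht).le).ne'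
    exact this
  have hanti : AntitoneOn k (Ici t0) := by
    refine antitoneOn_of_deriv_nonpos (convex_Ici t0)
      (fun t ht => (hder t ht).continuousAt.continuousWithinAt)
      (fun t ht => (hder t (interior_subset ht)).differentiableAt.differentiableWithinAt)
      (fun t ht => ?_)
    have ht' : t0 ≤ t := interior_subset ht
    rw [(hder t ht').deriv]
    obtain ⟨h1, h2⟩ := hprop t ht'
    refine div_nonpos_of_nonpos_of_nonneg ?_ (by positivity)
    have h3 : 0 ≤ deriv f t ^ (2 * n) := pow_nonneg (by linarith) _
    have h4 := mul_le_mul_of_nonneg_left h1 h3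
    push_cast
    have e : (2 * (n:ℝ) + 1) * deriv f t ^ (2 * n) * deriv (deriv f) t * f t -
        deriv f t ^ (2 * n + 1) * deriv f t = deriv f t ^ (2 * n) *
        ((2 * n + 1) * (f t * deriv (deriv f) t)) - deriv f t ^ (2 * n) * deriv f t ^ 2 := by ring
    rw [e]; linarith
  have hA : 0 < k t0 := by
    have := (hprop t0 le_rfl).2
    exact div_pos (pow_pos (by linarith) _) (hfp t0 (hge t0 le_rfl).le)
  refine ⟨2 ^ (2 * n + 1) * k t0 + f t0 ^ (2 * n), by
    have := hfp t0 (hge t0 le_rfl).le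
    positivity, fun t ht => ?_⟩
  have hft := hfp t ht
  have hft0 := hfp t0 (hge t0 le_rfl).le
  rcases le_or_gt t0 t with h | h
  · obtain ⟨h1, h2⟩ := hprop t h
    have h3 : k t ≤ k t0 := hanti (mem_Ici.2 le_rfl) h h
    have h4 : deriv f t ^ (2 * n + 1) ≤ k t0 * f t := by
      rwa [hk, div_le_iff₀ hft] at h3
    have h5 := tangent hf le_rfl (hge t h)
    have ht1 : 1 ≤ t := (le_max_right _ _).trans h
    have h6 : f t ≤ 2 * t * deriv f t := by nlinarith
    have h7 : f t ^ (2 * n + 1) ≤ (2 * t) ^ (2 * n + 1) * (k t0 * f t) := by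
      calc f t ^ (2 * n + 1) ≤ (2 * t * deriv f t) ^ (2 * n + 1) := by gcongr
        _ = (2 * t) ^ (2 * n + 1) * deriv f t ^ (2 * n + 1) := mul_pow _ _ _
        _ ≤ _ := by gcongr
    have h8 : f t ^ (2 * n) ≤ (2 * t) ^ (2 * n + 1) * k t0 := by
      rw [pow_succ (f t), ← mul_assoc] at h7
      exact le_of_mul_le_mul_right h7 hft
    calc f t ^ (2 * n) ≤ (2 * t) ^ (2 * n + 1) * k t0 := h8
      _ = 2 ^ (2 * n + 1) * k t0 * t ^ (2 * n + 1) := by rw [mul_pow]; ring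
      _ ≤ (2 ^ (2 * n + 1) * k t0 + f t0 ^ (2 * n)) * (1 + t) ^ (2 * n + 1) := by
        gcongr
        · have : 0 ≤ f t0 ^ (2 * n) := by positivity
          linarith
        · linarith
  · have h1 : f t ≤ f t0 := f_mono hf (mem_Ici.2 ht) (mem_Ici.2 (hge t0 le_rfl).le) h.le
    have h2 : (1:ℝ) ≤ (1 + t) ^ (2 * n + 1) := one_le_pow₀ (by linarith)
    have h3 : f t ^ (2 * n) ≤ f t0 ^ (2 * n) := by gcongr
    have h4 : 0 ≤ 2 ^ (2 * n + 1) * k t0 := by positivity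
    have h5 : 0 ≤ f t0 ^ (2 * n) := by positivity
    nlinarith

end Nonlin

section Green

/-- A `C¹` truncation, vanishing on `(-∞, 1]` and of slope one on `[2, ∞)`. -/
def trunc (s : ℝ) : ℝ := ∫ t in (0:ℝ)..s, Real.smoothTransition (t - 1)

lemma trunc_cont : Continuous (fun t : ℝ => Real.smoothTransition (t - 1)) :=
  Real.smoothTransition.continuous.comp (continuous_id.sub continuous_const)

lemma trunc_hasDerivAt (s : ℝ) : HasDerivAt trunc (Real.smoothTransition (s - 1)) s :=
  intervalIntegral.integral_hasDerivAt_right (trunc_cont.intervalIntegrable _ _)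
    (trunc_cont.stronglyMeasurableAtFilter _ _) trunc_cont.continuousAt

lemma trunc_zero {s : ℝ} (hs : s ≤ 1) : trunc s = 0 := by
  have : EqOn (fun t : ℝ => Real.smoothTransition (t - 1)) (fun _ => 0) (uIcc 0 s) := by
    intro t ht
    apply Real.smoothTransition.zero_of_nonpos
    have : t ≤ max 0 s := ht.2
    have h2 : max 0 s ≤ 1 := max_le zero_le_one hs
    linarith
  rw [trunc, intervalIntegral.integral_congr this]
  simp

lemma trunc_abs (s : ℝ) : |trunc s| ≤ |s| := by
  have := intervalIntegral.norm_integral_le_of_norm_le_const (a := 0) (b := s) (C := 1)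
    (f := fun t : ℝ => Real.smoothTransition (t - 1)) (fun t _ => by
      rw [Real.norm_eq_abs, abs_of_nonneg (Real.smoothTransition.nonneg _)]
      exact Real.smoothTransition.le_one _)
  simpa [trunc] using this

lemma trunc_large {s : ℝ} (hs : 2 ≤ s) : trunc s = trunc 2 + (s - 2) := by
  have h := intervalIntegral.integral_add_adjacent_intervals
    (trunc_cont.intervalIntegrable (μ := volume) 0 2) (trunc_cont.intervalIntegrable 2 s)
  have h2 : EqOn (fun t : ℝ => Real.smoothTransition (t - 1)) (fun _ => 1) (uIcc 2 s) := by
    intro t ht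
    rw [uIcc_of_le hs] at ht
    apply Real.smoothTransition.one_of_one_le
    linarith [ht.1]
  rw [intervalIntegral.integral_congr h2] at h
  simp only [intervalIntegral.integral_const, smul_eq_mul, mul_one] at h
  rw [trunc, ← h, trunc]

variable {n : ℕ}

lemma green_dir {a g : EuclideanSpace ℝ (Fin n) → ℝ} (ha : ContDiff ℝ (⊤ : ℕ∞) a)
    (hg : ContDiff ℝ (⊤ : ℕ∞) g) {Ω : Set (EuclideanSpace ℝ (Fin n))} (ho : IsOpen Ω)
    (hb : Bornology.IsBounded Ω) (hpos : ∀ x ∈ Ω, 0 < a x) (hf : ∀ x ∈ frontier Ω, a x = 0)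
    (e : EuclideanSpace ℝ (Fin n)) :
    ∫ x in Ω, a x * fderiv ℝ g x e = - ∫ x in Ω, fderiv ℝ a x e * g x := by
  have hK : IsCompact (closure Ω) := hb.isCompact_closure
  have hIntOn : ∀ h : EuclideanSpace ℝ (Fin n) → ℝ, Continuous h → IntegrableOn h Ω := fun h hc =>
    (hc.continuousOn.integrableOn_compact hK).mono_set subset_closure
  have hac := ha.continuous
  have hgc := hg.continuous
  have ha' : Continuous (fun x => fderiv ℝ a x e) :=
    (ha.continuous_fderiv (by simp)).clm_apply continuous_const
  have hg' : Continuous (fun x => fderiv ℝ g x e) :=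
    (hg.continuous_fderiv (by simp)).clm_apply continuous_const
  have htc : Continuous trunc := continuous_iff_continuousAt.2 fun s =>
    (trunc_hasDerivAt s).continuousAt
  have hstep : ∀ k : ℕ, ∫ x in Ω, (trunc ((k + 1) * a x) / (k + 1)) * fderiv ℝ g x e =
      - ∫ x in Ω, (Real.smoothTransition ((k + 1) * a x - 1) * fderiv ℝ a x e) * g x := by
    intro k
    have hk : (0:ℝ) < k + 1 := by positivity
    set φ : EuclideanSpace ℝ (Fin n) → ℝ :=
      Ω.indicator (fun x => trunc ((k + 1) * a x) / (k + 1)) with hφ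
    have hder : ∀ x, HasFDerivAt φ (Ω.indicator
        (fun x => Real.smoothTransition ((k + 1) * a x - 1) • fderiv ℝ a x) x) x := by
      intro x
      by_cases hx : x ∈ Ω
      · have h1 : HasFDerivAt (fun x => trunc ((k + 1) * a x) / (k + 1))
            (Real.smoothTransition ((k + 1) * a x - 1) • fderiv ℝ a x) x := by
          have h2 := (((ha.differentiable (by simp) x).hasFDerivAt).const_mul ((k:ℝ) + 1))
          have h3 := ((trunc_hasDerivAt ((k + 1) * a x)).comp_hasFDerivAt x h2).mul_const
            (((k:ℝ) + 1)⁻¹)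
          refine (h3.congr_fderiv ?_)
          rw [smul_smul, smul_smul]
          congr 1
          field_simp
        rw [indicator_of_mem hx]
        refine h1.congr_of_eventuallyEq ?_
        filter_upwards [ho.mem_nhds hx] with y hy
        rw [hφ, indicator_of_mem hy]
      · rw [indicator_of_notMem hx]
        have hz : φ =ᶠ[𝓝 x] fun _ => 0 := by
          by_cases hxc : x ∈ closure Ω
          · have hax : a x = 0 := hf x ⟨hxc, by rwa [ho.interior_eq]⟩
            have : ∀ᶠ y in 𝓝 x, (k + 1) * a y < 1 := by
              have hc : Continuous fun y => ((k:ℝ) + 1) * a y := continuous_const.mul hac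
              exact hc.continuousAt.eventually (gt_mem_nhds (by simp [hax]))
            filter_upwards [this] with y hy
            by_cases hyO : y ∈ Ω
            · rw [hφ, indicator_of_mem hyO, trunc_zero hy.le, zero_div]
            · rw [hφ, indicator_of_notMem hyO]
          · filter_upwards [isClosed_closure.isOpen_compl.mem_nhds hxc] with y hy
            rw [hφ, indicator_of_notMem fun h => hy (subset_closure h)]
        exact (hasFDerivAt_const (0:ℝ) x).congr_of_eventuallyEq hz
    have hfd : ∀ x, fderiv ℝ φ x e = Ω.indicator
        (fun x => Real.smoothTransition ((k + 1) * a x - 1) * fderiv ℝ a x e) x := by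
      intro x
      rw [(hder x).fderiv]
      by_cases hx : x ∈ Ω <;> simp [hx]
    have hSc : Continuous fun x => Real.smoothTransition ((k + 1) * a x - 1) :=
      Real.smoothTransition.continuous.comp ((continuous_const.mul hac).sub continuous_const)
    have hTc : Continuous fun x => trunc ((k + 1) * a x) / (k + 1) :=
      (htc.comp (continuous_const.mul hac)).div_const _
    have e1 : ∀ h : EuclideanSpace ℝ (Fin n) → ℝ, (fun x => φ x * h x) =
        Ω.indicator (fun x => trunc ((k + 1) * a x) / (k + 1) * h x) := by
      intro h; ext x
      by_cases hx : x ∈ Ω <;> simp [hφ, hx]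
    have e2 : (fun x => fderiv ℝ φ x e * g x) =
        Ω.indicator (fun x => Real.smoothTransition ((k + 1) * a x - 1) * fderiv ℝ a x e * g x) := by
      ext x
      rw [hfd]
      by_cases hx : x ∈ Ω <;> simp [hx]
    have ibp := integral_mul_fderiv_eq_neg_fderiv_mul_of_integrable (μ := volume) (f := φ) (g := g)
      (v := e)
      (by rw [e2, integrable_indicator_iff ho.measurableSet]
          exact hIntOn _ ((hSc.mul ha').mul hgc))
      (by rw [e1, integrable_indicator_iff ho.measurableSet]
          exact hIntOn _ (hTc.mul hg'))
      (by rw [e1, integrable_indicator_iff ho.measurableSet]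
          exact hIntOn _ (hTc.mul hgc))
      (fun x _ => (hder x).differentiableAt) (fun x _ => hg.differentiable (by simp) x)
    rw [e1, e2, integral_indicator ho.measurableSet, integral_indicator ho.measurableSet] at ibp
    exact ibp
  have hlarge : ∀ x ∈ Ω, ∀ᶠ k : ℕ in atTop, 2 ≤ ((k:ℝ) + 1) * a x := by
    intro x hx
    have : Tendsto (fun k : ℕ => ((k:ℝ) + 1) * a x) atTop atTop :=
      (tendsto_atTop_add_const_right _ _ tendsto_natCast_atTop_atTop).atTop_mul_const (hpos x hx)
    exact this.eventually_ge_atTop 2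
  have hL : Tendsto (fun k : ℕ => ∫ x in Ω, (trunc ((k + 1) * a x) / (k + 1)) * fderiv ℝ g x e)
      atTop (𝓝 (∫ x in Ω, a x * fderiv ℝ g x e)) := by
    refine tendsto_integral_of_dominated_convergence (fun x => |a x| * |fderiv ℝ g x e|) ?_ ?_ ?_ ?_
    · intro k
      exact (((htc.comp (continuous_const.mul hac)).div_const _).mul hg').aestronglyMeasurable
    · exact hIntOn _ (hac.abs.mul hg'.abs)
    · intro k
      refine ae_of_all _ fun x => ?_
      rw [norm_mul, Real.norm_eq_abs, Real.norm_eq_abs]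
      refine mul_le_mul_of_nonneg_right ?_ (abs_nonneg _)
      have hk : (0:ℝ) < k + 1 := by positivity
      rw [abs_div, abs_of_pos hk, div_le_iff₀ hk]
      refine (trunc_abs _).trans ?_
      rw [abs_mul, abs_of_pos hk, mul_comm]
    · refine (ae_restrict_iff' ho.measurableSet).2 (ae_of_all _ fun x hx => ?_)
      refine Tendsto.mul_const _ ?_
      have h1 : Tendsto (fun k : ℕ => (trunc 2 - 2) * (1 / ((k:ℝ) + 1)) + a x) atTop
          (𝓝 ((trunc 2 - 2) * 0 + a x)) :=
        (tendsto_one_div_add_atTop_nhds_zero_nat.const_mul _).add_const _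
      rw [mul_zero, zero_add] at h1
      refine h1.congr' ?_
      filter_upwards [hlarge x hx] with k hk
      rw [trunc_large hk]
      have hk : (0:ℝ) < k + 1 := by positivity
      field_simp
      ring
  have hRt : Tendsto (fun k : ℕ => ∫ x in Ω,
      (Real.smoothTransition ((k + 1) * a x - 1) * fderiv ℝ a x e) * g x)
      atTop (𝓝 (∫ x in Ω, fderiv ℝ a x e * g x)) := by
    refine tendsto_integral_of_dominated_convergence (fun x => |fderiv ℝ a x e| * |g x|) ?_ ?_ ?_ ?_
    · intro k
      have hSc : Continuous fun x => Real.smoothTransition ((k + 1) * a x - 1) :=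
        Real.smoothTransition.continuous.comp ((continuous_const.mul hac).sub continuous_const)
      exact ((hSc.mul ha').mul hgc).aestronglyMeasurable
    · exact hIntOn _ (ha'.abs.mul hgc.abs)
    · intro k
      refine ae_of_all _ fun x => ?_
      rw [norm_mul, norm_mul, Real.norm_eq_abs, Real.norm_eq_abs, Real.norm_eq_abs,
        abs_of_nonneg (Real.smoothTransition.nonneg _)]
      gcongr
      exact mul_le_of_le_one_left (abs_nonneg _) (Real.smoothTransition.le_one _)
    · refine (ae_restrict_iff' ho.measurableSet).2 (ae_of_all _ fun x hx => ?_)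
      refine tendsto_const_nhds.congr' ?_
      filter_upwards [hlarge x hx] with k hk
      rw [Real.smoothTransition.one_of_one_le (by linarith), one_mul]
  refine tendsto_nhds_unique hL ?_
  simp only [hstep]
  exact hRt.neg

lemma green {a b : EuclideanSpace ℝ (Fin n) → ℝ} (ha : ContDiff ℝ (⊤ : ℕ∞) a)
    (hb' : ContDiff ℝ (⊤ : ℕ∞) b) {Ω : Set (EuclideanSpace ℝ (Fin n))} (ho : IsOpen Ω)
    (hb : Bornology.IsBounded Ω) (hpos : ∀ x ∈ Ω, 0 < a x) (hf : ∀ x ∈ frontier Ω, a x = 0) :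
    ∫ x in Ω, a x * lap b x = - ∑ i : Fin n, ∫ x in Ω, fderiv ℝ a x (EuclideanSpace.single i (1:ℝ)) *
      fderiv ℝ b x (EuclideanSpace.single i (1:ℝ)) := by
  have hK : IsCompact (closure Ω) := hb.isCompact_closure
  have h1 : ContDiff ℝ (⊤ : ℕ∞) (fderiv ℝ b) := hb'.fderiv_right (by simp)
  have hs : ∀ i : Fin n, ContDiff ℝ (⊤ : ℕ∞)
      (fun x => fderiv ℝ b x (EuclideanSpace.single i (1:ℝ))) := fun i =>
    h1.clm_apply contDiff_const
  have e : ∀ x, a x * lap b x = ∑ i : Fin n, a x * fderiv ℝ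
      (fun x => fderiv ℝ b x (EuclideanSpace.single i (1:ℝ))) x (EuclideanSpace.single i (1:ℝ)) := by
    intro x
    rw [lap_eq, Finset.mul_sum]
    refine Finset.sum_congr rfl fun i _ => ?_
    congr 1
    have := ((h1.differentiable (by simp) x).hasFDerivAt.clm_apply
      (hasFDerivAt_const (EuclideanSpace.single i (1:ℝ)) x)).fderiv
    rw [this]
    simp
  simp only [e]
  rw [integral_finsetSum, ← Finset.sum_neg_distrib]
  · exact Finset.sum_congr rfl fun i _ => green_dir ha (hs i) ho hb hpos hf _
  · intro i _
    exact ((ha.continuous.mul (((hs i).continuous_fderiv (by simp)).clm_apply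
      continuous_const)).continuousOn.integrableOn_compact hK).mono_set subset_closure

lemma green_symm {a b : EuclideanSpace ℝ (Fin n) → ℝ} (ha : ContDiff ℝ (⊤ : ℕ∞) a)
    (hb' : ContDiff ℝ (⊤ : ℕ∞) b) {Ω : Set (EuclideanSpace ℝ (Fin n))} (ho : IsOpen Ω)
    (hb : Bornology.IsBounded Ω) (hpos : ∀ x ∈ Ω, 0 < a x) (hf : ∀ x ∈ frontier Ω, a x = 0)
    (hpos' : ∀ x ∈ Ω, 0 < b x) (hf' : ∀ x ∈ frontier Ω, b x = 0) :
    ∫ x in Ω, a x * lap b x = ∫ x in Ω, b x * lap a x := by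
  rw [green ha hb' ho hb hpos hf, green hb' ha ho hb hpos' hf']
  simp only [mul_comm]

end Green

section Main

lemma final_num {n : ℕ} (hn : 0 < n) {P D B M : ℝ} (hP : 0 < P) (hB : 0 < B) (hM : 0 < M)
    (h : P * M ^ n ≤ D * √(B * (1 + M) ^ (2 * n - 1))) :
    M ≤ max 1 (D ^ 2 * B * 2 ^ (2 * n - 1) / P ^ 2) := by
  rcases le_or_gt M 1 with h1 | h1
  · exact h1.trans (le_max_left _ _)
  refine le_trans ?_ (le_max_right _ _)
  have h2 : (P * M ^ n) ^ 2 ≤ (D * √(B * (1 + M) ^ (2 * n - 1))) ^ 2 := by gcongr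
  rw [mul_pow D, Real.sq_sqrt (by positivity)] at h2
  have h3 : (1 + M) ^ (2 * n - 1) ≤ (2 * M) ^ (2 * n - 1) := by gcongr; linarith
  have h4 : (P * M ^ n) ^ 2 = P ^ 2 * M * M ^ (2 * n - 1) := by
    have : M ^ (2 * n - 1) * M = M ^ (2 * n) := by
      rw [← pow_succ]; congr 1; omega
    rw [mul_pow, ← pow_mul, mul_comm n 2, ← this]; ring
  have h5 : P ^ 2 * M * M ^ (2 * n - 1) ≤ (D ^ 2 * B * 2 ^ (2 * n - 1)) * M ^ (2 * n - 1) := by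
    rw [← h4]
    refine h2.trans ?_
    calc D ^ 2 * (B * (1 + M) ^ (2 * n - 1)) ≤ D ^ 2 * (B * (2 * M) ^ (2 * n - 1)) := by gcongr
      _ = _ := by rw [mul_pow]; ring
  have h6 := le_of_mul_le_mul_right h5 (by positivity)
  rw [le_div_iff₀ (by positivity)]
  linarith

lemma main_bound {n : ℕ} (Ω : Set (EuclideanSpace ℝ (Fin n))) (hΩ : GoodDomain Ω)
    (f : ℝ → ℝ) (hf : HypH ⊤ f)
    (hτ : Filter.Tendsto (fun t => f t * deriv (deriv f) t / (deriv f t) ^ 2)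
      Filter.atTop (nhds 0)) :
    ∃ C : ℝ, ∀ l : ℝ, 0 < l → ∀ u, Solves Ω ⊤ l f u → Semistable Ω l f u →
      ∀ x ∈ Ω, u x ≤ C := by
  obtain ⟨ho, hb, x0, hx0⟩ := hΩ
  have hfp : ∀ t, 0 ≤ t → 0 < f t := fun t ht => hf.pos t (by rw [domf_top]; exact ht)
  rcases Nat.eq_zero_or_pos n with rfl | hn
  · refine ⟨0, fun l hl u hu _ x hx => ?_⟩
    exfalso
    have h1 := hu.2.2.1 x hx
    have h2 : lap (lap u) x = 0 := by simp [lap]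
    have h3 := hfp (u x) (hu.2.1 x hx).1
    rw [h2] at h1
    have := mul_pos hl h3
    linarith
  have hn1 : (1:ℝ) ≤ n := by exact_mod_cast hn
  have hn0 : (0:ℝ) < n := by linarith
  have hf0 := hf.f0_pos
  obtain ⟨R0, hR0⟩ := hb.subset_closedBall (0 : EuclideanSpace ℝ (Fin n))
  set R := max R0 1 with hRdef
  have hRpos : 0 < R := lt_of_lt_of_le one_pos (le_max_right _ _)
  have hR : Ω ⊆ Metric.closedBall 0 R := hR0.trans (Metric.closedBall_subset_closedBall
    (le_max_left _ _))
  obtain ⟨r, hr, hball⟩ := Metric.nhds_basis_closedBall.mem_iff.1 (ho.mem_nhds hx0)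
  obtain ⟨K, hKg⟩ := g_lower hf
  obtain ⟨B, hB, hgrow⟩ := growth hf hτ n
  set m : ℝ := volume.real Ω with hm
  have hfin : volume Ω ≠ ⊤ := hb.measure_lt_top.ne
  set κ : ℝ := f 0 * r ^ 2 / (8 * n) * (r / 2) ^ 2 / (8 * n) with hκ
  have hκpos : 0 < κ := by positivity
  set β : ℝ := volume.real (Metric.closedBall x0 (r / 2 / 2)) with hβ
  have hβpos : 0 < β := by
    refine ENNReal.toReal_pos (Metric.measure_closedBall_pos volume x0 (by positivity)).ne' ?_
    exact (isCompact_closedBall x0 _).measure_lt_top.ne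
  set ω : ℝ := volume.real (Metric.ball (0 : EuclideanSpace ℝ (Fin n)) 1) with hω
  have hωpos : 0 < ω := by
    refine ENNReal.toReal_pos (Metric.measure_ball_pos volume _ one_pos).ne' ?_
    exact Metric.isBounded_ball.measure_lt_top.ne
  set L : ℝ := K * m / (κ * β) with hL
  set D : ℝ := L ^ n * (m + K * m) with hD
  set P : ℝ := ω / (2 * R ^ 3) ^ n with hP
  refine ⟨max 1 (D ^ 2 * B * 2 ^ (2 * n - 1) / P ^ 2), fun l hl u hu hsemi => ?_⟩
  obtain ⟨hus, hu0, heq, hub, hlb⟩ := hu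
  have hlus := lap_smooth hus
  have hcpt : IsCompact (closure Ω) := hb.isCompact_closure
  -- positivity
  have hlneg : ∀ x ∈ Ω, lap u x < 0 := maxp hlus ho hb
    (fun x hx => by rw [heq x hx]; exact mul_pos hl (hfp _ (hu0 x hx).1)) (fun x hx => (hlb x hx).le)
  have hupos : ∀ x ∈ Ω, 0 < u x := by
    have := maxp hus.neg ho hb (fun x hx => by
      have h := lap_neg u x
      have h2 := hlneg x hx
      change 0 < lap (fun y => - u y) x
      linarith) (fun x hx => by simp [hub x hx])
    intro x hx
    have := this x hx
    linarith
  set v : EuclideanSpace ℝ (Fin n) → ℝ := fun x => - lap u x with hv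
  have hvs : ContDiff ℝ (⊤ : ℕ∞) v := hlus.neg
  have hvpos : ∀ x ∈ Ω, 0 < v x := fun x hx => by have := hlneg x hx; simp only [hv]; linarith
  have hvb : ∀ x ∈ frontier Ω, v x = 0 := fun x hx => by simp [hv, hlb x hx]
  have hlapv : ∀ x ∈ Ω, lap v x = - (l * f (u x)) := fun x hx => by
    rw [hv, lap_neg, heq x hx]
  -- maxima
  obtain ⟨y, hy, hymax⟩ := hcpt.exists_isMaxOn ⟨x0, subset_closure hx0⟩ hus.continuous.continuousOn
  have hyO : y ∈ Ω := by
    by_contra hyO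
    have h1 := hub y ⟨hy, by rwa [ho.interior_eq]⟩
    have h2 : u x0 ≤ u y := hymax (subset_closure hx0)
    have := hupos x0 hx0
    linarith
  obtain ⟨z, hz, hzmax⟩ := hcpt.exists_isMaxOn ⟨x0, subset_closure hx0⟩ hvs.continuous.continuousOn
  have hzO : z ∈ Ω := by
    by_contra hzO
    have h1 := hvb z ⟨hz, by rwa [ho.interior_eq]⟩
    have h2 : v x0 ≤ v z := hzmax (subset_closure hx0)
    have := hvpos x0 hx0
    linarith
  set M := u y with hM
  set V := v z with hVdef
  have hMpos : 0 < M := hupos y hyO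
  have hVpos : 0 < V := hvpos z hzO
  have huM : ∀ x ∈ Ω, u x ≤ M := fun x hx => hymax (subset_closure hx)
  have hvV : ∀ x ∈ Ω, v x ≤ V := fun x hx => hzmax (subset_closure hx)
  -- integrability
  have hIntOn : ∀ h : EuclideanSpace ℝ (Fin n) → ℝ, Continuous h → IntegrableOn h Ω := fun h hc =>
    (hc.continuousOn.integrableOn_compact hcpt).mono_set subset_closure
  have hIntOnB : ∀ (h : EuclideanSpace ℝ (Fin n) → ℝ) (c : ℝ), ContinuousOn h Ω →
      (∀ x ∈ Ω, |h x| ≤ c) → IntegrableOn h Ω := fun h c hc hbd =>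
    Integrable.mono' (g := fun _ => c) (hIntOn _ continuous_const)
      (hc.aestronglyMeasurable ho.measurableSet) ((ae_restrict_iff' ho.measurableSet).2 (ae_of_all _ hbd))
  have huc := hus.continuous
  have hfu : ContinuousOn (fun x => f (u x)) Ω := fun x hx =>
    ((f_diff hf (hupos x hx)).continuousAt.comp huc.continuousAt).continuousWithinAt
  have hf'u : ContinuousOn (fun x => deriv f (u x)) Ω := fun x hx =>
    ((((f'_smooth hf).continuousOn).continuousAt (Ioi_mem_nhds (hupos x hx))).comp
      huc.continuousAt).continuousWithinAt
  have hi1 : IntegrableOn (fun x => (lap u x) ^ 2) Ω := hIntOn _ (hlus.continuous.pow 2)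
  have hi2 : IntegrableOn (fun x => l * deriv f (u x) * (u x) ^ 2) Ω := by
    refine hIntOnB _ (l * deriv f M * M ^ 2)
      ((continuousOn_const.mul hf'u).mul (huc.pow 2).continuousOn) fun x hx => ?_
    have h1 := f'_nonneg hf (hupos x hx)
    have h2 := f'_mono hf (hupos x hx) hMpos (huM x hx)
    have h6 : 0 ≤ l * deriv f M := mul_nonneg hl.le (h1.trans h2)
    have h3 := hupos x hx
    have h4 := huM x hx
    rw [abs_of_nonneg (by positivity)]
    gcongr
  have hi3 : IntegrableOn (fun x => u x * (l * f (u x))) Ω := by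
    refine hIntOnB _ (M * (l * f M)) (huc.continuousOn.mul (continuousOn_const.mul hfu)) fun x hx => ?_
    have h3 := hupos x hx
    have h1 := hfp _ h3.le
    have h2 := f_mono hf h3.le hMpos.le (huM x hx)
    have h4 := huM x hx
    rw [abs_of_nonneg (by positivity)]
    gcongr
  -- energy identity
  have hE : ∫ x in Ω, (lap u x) ^ 2 = ∫ x in Ω, u x * (l * f (u x)) := by
    have h := green_symm hus hvs ho hb hupos hub hvpos hvb
    have e1 : ∫ x in Ω, u x * lap v x = - ∫ x in Ω, u x * (l * f (u x)) := by
      rw [← integral_neg]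
      refine setIntegral_congr_fun ho.measurableSet fun x hx => ?_
      simp only [hlapv x hx]; ring
    have e2 : ∫ x in Ω, v x * lap u x = - ∫ x in Ω, (lap u x) ^ 2 := by
      rw [← integral_neg]
      refine setIntegral_congr_fun ho.measurableSet fun x hx => ?_
      simp only [hv]; ring
    rw [e1, e2] at h
    linarith
  have hS := hsemi u hus hub
  rw [integral_sub hi1 hi2, hE] at hS
  -- L¹ bound
  have hU : ∫ x in Ω, u x ≤ K * m := by
    have h1 : ∫ x in Ω, l * (u x - K) ≤ ∫ x in Ω, (l * deriv f (u x) * (u x) ^ 2 -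
        u x * (l * f (u x))) := by
      refine setIntegral_mono_on (hIntOn _ (continuous_const.mul (huc.sub continuous_const)))
        (hi2.sub hi3) ho.measurableSet fun x hx => ?_
      have := mul_le_mul_of_nonneg_left (hKg (u x) (hupos x hx)) hl.le
      refine this.trans (le_of_eq ?_)
      ring
    rw [integral_sub hi2 hi3, integral_const_mul,
      integral_sub (hIntOn _ huc) (hIntOn _ continuous_const), setIntegral_const, smul_eq_mul] at h1
    have h2 : l * ((∫ x in Ω, u x) - m * K) ≤ 0 := by rw [hm]; linarith
    have h3 := nonpos_of_mul_nonpos_right h2 hl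
    linarith
  have hU0 : 0 ≤ ∫ x in Ω, u x := setIntegral_nonneg ho.measurableSet fun x hx => (hupos x hx).le
  -- bound on l
  have hlL : l ≤ L := by
    have hb2 : Metric.closedBall x0 (r / 2) ⊆ Metric.closedBall x0 r :=
      Metric.closedBall_subset_closedBall (by linarith)
    have hb3 : Metric.closedBall x0 (r / 2 / 2) ⊆ Metric.closedBall x0 (r / 2) :=
      Metric.closedBall_subset_closedBall (by linarith)
    have h1 := lower_barrier hvs (x0 := x0) hr (mul_pos hl hf0) hn
      (fun x hx => (hvpos x (hball hx)).le) (fun x hx => by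
        rw [hlapv x (hball hx), neg_neg]
        gcongr
        exact f_mono hf (mem_Ici.2 le_rfl) (hupos x (hball hx)).le (hupos x (hball hx)).le)
    have h2 := lower_barrier hus (x0 := x0) (r := r / 2) (c := l * f 0 * r ^ 2 / (8 * n))
      (by positivity) (by positivity) hn
      (fun x hx => (hupos x (hball (hb2 hx))).le) h1
    have h3 : l * κ * β ≤ ∫ x in Ω, u x := by
      have h4 : ∫ x in Metric.closedBall x0 (r / 2 / 2), l * κ ≤
          ∫ x in Metric.closedBall x0 (r / 2 / 2), u x := by
        refine setIntegral_mono_on ?_ ((hIntOn _ huc).mono_set ((hb3.trans hb2).trans hball))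
          measurableSet_closedBall fun x hx => ?_
        · exact (hIntOn _ continuous_const).mono_set ((hb3.trans hb2).trans hball)
        · refine le_trans (le_of_eq ?_) (h2 x hx)
          rw [hκ]; ring
      rw [setIntegral_const, smul_eq_mul] at h4
      have h5 : ∫ x in Metric.closedBall x0 (r / 2 / 2), u x ≤ ∫ x in Ω, u x :=
        setIntegral_mono_set (hIntOn _ huc)
          ((ae_restrict_iff' ho.measurableSet).2 (ae_of_all _ fun x hx => (hupos x hx).le))
          (LE.le.eventuallyLE ((hb3.trans hb2).trans hball))
      linarith
    rw [hL, le_div_iff₀ (by positivity)]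
    linarith
  -- sup bounds
  have hMV : M ≤ V * R ^ 2 :=
    upper_barrier hus ho hn hR hVpos (fun x hx => hvV x hx) (fun x hx => (hub x hx).le) y hyO
  have habp := abp hvs ho hRpos hR hvb hzO hVpos
  set Q := √(B * (1 + M) ^ (2 * n - 1)) with hQ
  have hpt : ∀ x ∈ Ω, |lap v x| ^ n ≤ l ^ n * (Q * (1 + u x)) := by
    intro x hx
    have h3 := hupos x hx
    have h1 := hfp _ h3.le
    rw [hlapv x hx, abs_neg, abs_of_pos (by positivity), mul_pow]
    gcongr
    refine le_of_sq_le_sq ?_ (by positivity)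
    rw [← pow_mul, mul_comm n 2, mul_pow, hQ, Real.sq_sqrt (by positivity)]
    refine (hgrow _ h3.le).trans ?_
    have e : (1 + u x) ^ (2 * n + 1) = (1 + u x) ^ (2 * n - 1) * (1 + u x) ^ 2 := by
      rw [← pow_add]; congr 1; omega
    rw [e, mul_assoc]
    have h4 := huM x hx
    gcongr
  have hI : ∫ x in Ω, |lap v x| ^ n ≤ l ^ n * (Q * (m + ∫ x in Ω, u x)) := by
    have hc2 : IntegrableOn (fun x => l ^ n * (Q * (1 + u x))) Ω :=
      hIntOn _ (continuous_const.mul (continuous_const.mul (continuous_const.add huc)))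
    refine (setIntegral_mono_on (hIntOn _ ((lap_smooth hvs).continuous.abs.pow n)) hc2
      ho.measurableSet hpt).trans (le_of_eq ?_)
    rw [integral_const_mul, integral_const_mul, integral_add (hIntOn _ continuous_const) (hIntOn _ huc),
      setIntegral_const]
    simp [hm]
  have hfinal : P * M ^ n ≤ D * Q := by
    have hL0 : 0 ≤ L := hl.le.trans hlL
    have hLn : 0 ≤ L ^ n := pow_nonneg hL0 n
    have hm0 : 0 ≤ m := measureReal_nonneg
    have hQ0 : 0 ≤ Q := Real.sqrt_nonneg _
    calc P * M ^ n = ω * (M / (2 * R ^ 3)) ^ n := by rw [hP, div_pow]; ring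
      _ ≤ ω * (V / (2 * R)) ^ n := by
        gcongr ω * ?_ ^ n
        rw [div_le_div_iff₀ (by positivity) (by positivity)]
        have : M * (2 * R) ≤ V * R ^ 2 * (2 * R) := by gcongr
        refine this.trans (le_of_eq ?_)
        ring
      _ ≤ l ^ n * (Q * (m + ∫ x in Ω, u x)) := habp.trans hI
      _ ≤ L ^ n * (Q * (m + K * m)) := by gcongr
      _ = D * Q := by rw [hD]; ring
  have := final_num hn (by positivity) hB hMpos hfinal
  intro x hx
  exact (huM x hx).trans this

end Main

/-- For a regular nonlinearity `f` satisfying (H) with `lim_{t→∞} f f''/(f')² = 0`, in every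
dimension `n` and for every smooth bounded domain `Ω`, any sequence of semistable solutions
of `(N_{λ_m})` is uniformly bounded in `L^∞(Ω)`, and the extremal solution `u*` is bounded. -/
theorem statement13 {n : ℕ} (Ω : Set (EuclideanSpace ℝ (Fin n))) (hΩ : GoodDomain Ω)
    (f : ℝ → ℝ) (hf : HypH ⊤ f)
    (hτ : Filter.Tendsto (fun t => f t * deriv (deriv f) t / (deriv f t) ^ 2)
      Filter.atTop (nhds 0))
    (lam : ℕ → ℝ) (hlam : ∀ m, 0 < lam m)
    (u : ℕ → EuclideanSpace ℝ (Fin n) → ℝ)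
    (hsol : ∀ m, Solves Ω ⊤ (lam m) f (u m))
    (hsemi : ∀ m, Semistable Ω (lam m) f (u m))
    (lamstar : ℝ) (hls : 0 < lamstar)
    (uf : ℝ → EuclideanSpace ℝ (Fin n) → ℝ)
    (hsolf : ∀ l ∈ Ioo (0:ℝ) lamstar, Solves Ω ⊤ l f (uf l))
    (hminf : ∀ l ∈ Ioo (0:ℝ) lamstar, ∀ v, Solves Ω ⊤ l f v → ∀ x ∈ Ω, uf l x ≤ v x)
    (hsemif : ∀ l ∈ Ioo (0:ℝ) lamstar, Semistable Ω l f (uf l))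
    (ustar : EuclideanSpace ℝ (Fin n) → ℝ)
    (hlim : ∀ x ∈ Ω, Filter.Tendsto (fun l => uf l x) (nhdsWithin lamstar (Set.Iio lamstar))
      (nhds (ustar x))) :
    (∃ C : ℝ, ∀ m, ∀ x ∈ Ω, u m x ≤ C) ∧
    (∃ C : ℝ, ∀ x ∈ Ω, ustar x ≤ C) := by
  obtain ⟨C, hC⟩ := main_bound Ω hΩ f hf hτ
  refine ⟨⟨C, fun m x hx => hC (lam m) (hlam m) (u m) (hsol m) (hsemi m) x hx⟩, C, fun x hx => ?_⟩
  refine le_of_tendsto (hlim x hx) ?_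
  filter_upwards [Ioo_mem_nhdsLT hls] with l hl
  exact hC l hl.1 (uf l) (hsolf l hl) (hsemif l hl) x hx

end
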